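/- For d = 4, the Poincaré series of the algebra of covariants of the binary 4-form satisfies P_4(z) = (1 + z³)/((1 − z)(1 − z²)²(1 − z³)), i.e. ∑_{n≥0} dim(S_n) z^n = (1 + z³) · ((1 − z)(1 − z²)²(1 − z³))^{−1} in ℂ[[z]]. -/

import Mathlib

noncomputable section

/-- The derivation D₁ on ℂ[x_0,…,x_d] with D₁(x_0)=0 and D₁(x_i)=i·x_{i-1}
(for i = 0 the coefficient i vanishes, so the wrap-around in `Fin` is harmless). -/
def D1 (d : ℕ) :
    Derivation ℂ (MvPolynomial (Fin (d + 1)) ℂ) (MvPolynomial (Fin (d + 1)) ℂ) :=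
  MvPolynomial.mkDerivation ℂ (fun i => (i.val : ℂ) • MvPolynomial.X (i - 1))

/-- S_n: the space of homogeneous degree-n seminvariants of the binary d-form. -/
def Sn (d n : ℕ) : Submodule ℂ (MvPolynomial (Fin (d + 1)) ℂ) :=
  MvPolynomial.homogeneousSubmodule (Fin (d + 1)) ℂ n ⊓ LinearMap.ker (D1 d).toLinearMap

/-- The Poincaré series P_d(z) = ∑_{n≥0} dim(S_n) zⁿ of the algebra of covariants. -/
def PSeries (d : ℕ) : PowerSeries ℂ :=
  PowerSeries.mk fun n => (Module.finrank ℂ (Sn d n) : ℂ)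

section WeightedHomogeneous

open MvPolynomial

variable {σ R M : Type*} [CommSemiring R]

theorem MvPolynomial.IsWeightedHomogeneous.mkDerivation [AddCommMonoid M] {w : σ → M} {t m : M}
    {f : σ → MvPolynomial σ R} (hf : ∀ i, IsWeightedHomogeneous w (f i) (w i + t))
    {p : MvPolynomial σ R} (hp : IsWeightedHomogeneous w p m) :
    IsWeightedHomogeneous w (MvPolynomial.mkDerivation R f p) (m + t) := by
  rw [p.as_sum, map_sum]
  refine IsWeightedHomogeneous.sum _ _ _ fun s hs => ?_
  rw [mkDerivation_monomial, Finsupp.sum, Finset.smul_sum]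
  refine IsWeightedHomogeneous.sum _ _ _ fun i hi => ?_
  rw [smul_eq_mul, smul_eq_C_mul]
  refine IsWeightedHomogeneous.C_mul ?_ _
  have h : m + t = Finsupp.weight w (s - Finsupp.single i 1) + (w i + t) := by
    rw [← add_assoc, Finsupp.weight_sub_single_add (Finsupp.mem_support_iff.1 hi),
      hp (mem_support_iff.1 hs)]
  rw [h]
  exact (isWeightedHomogeneous_monomial _ _ _ rfl).mul (hf i)

theorem MvPolynomial.mkDerivation_weightedHomogeneousComponent [AddCancelCommMonoid M]
    {w : σ → M} {t : M} {f : σ → MvPolynomial σ R}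
    (hf : ∀ i, IsWeightedHomogeneous w (f i) (w i + t)) (m : M) (p : MvPolynomial σ R) :
    MvPolynomial.mkDerivation R f (weightedHomogeneousComponent w m p) =
      weightedHomogeneousComponent w (m + t) (MvPolynomial.mkDerivation R f p) := by
  classical
  rw [p.as_sum]
  simp only [map_sum]
  refine Finset.sum_congr rfl fun s _ => ?_
  have hs : IsWeightedHomogeneous w (monomial s (coeff s p)) (Finsupp.weight w s) :=
    isWeightedHomogeneous_monomial _ _ _ rfl
  rw [weightedHomogeneousComponent_of_mem hs,
    weightedHomogeneousComponent_of_mem (hs.mkDerivation hf)]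
  simp only [add_left_inj]
  split_ifs <;> simp

end WeightedHomogeneous

section CountingSeries

open PowerSeries

variable {α : Type*}

theorem finite_fiber_prod_nat {deg : α → ℕ} (hfin : ∀ n, {a | deg a = n}.Finite) {k : ℕ}
    (hk : 0 < k) (n : ℕ) : {x : α × ℕ | deg x.1 + k * x.2 = n}.Finite := by
  refine (((Set.finite_Iic n).biUnion fun m _ => hfin m).prod (Set.finite_Iic n)).subset ?_
  rintro ⟨a, t⟩ h
  simp only [Set.mem_ofPred_eq] at h
  have := Nat.le_mul_of_pos_left t hk
  simp only [Set.mem_prod, Set.mem_iUnion, Set.mem_Iic, Set.mem_ofPred_eq, exists_prop,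
    exists_eq_right']
  omega

/-- The generating series counting the elements of `α` by degree. -/
def countingSeries (R : Type*) [Ring R] (deg : α → ℕ) : PowerSeries R :=
  PowerSeries.mk fun n => ({a | deg a = n}.ncard : R)

theorem ncard_fiber_prod_nat {deg : α → ℕ} (hfin : ∀ n, {a | deg a = n}.Finite) {k : ℕ}
    (hk : 0 < k) (n : ℕ) :
    {x : α × ℕ | deg x.1 + k * x.2 = n}.ncard = {a | deg a = n}.ncard +
      if k ≤ n then {x : α × ℕ | deg x.1 + k * x.2 = n - k}.ncard else 0 := by
  have hinj : Function.Injective fun a : α => (a, 0) := fun a b h => (Prod.ext_iff.1 h).1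
  have hinj' : Function.Injective fun x : α × ℕ => (x.1, x.2 + 1) := by
    rintro ⟨a, t⟩ ⟨b, u⟩ h
    simpa using h
  split_ifs with hkn
  · rw [← Set.ncard_image_of_injective {a | deg a = n} hinj,
      ← Set.ncard_image_of_injective {x : α × ℕ | deg x.1 + k * x.2 = n - k} hinj',
      ← Set.ncard_union_eq _ ((hfin n).image _) ((finite_fiber_prod_nat hfin hk _).image _)]
    · congr 1
      ext ⟨a, _ | t⟩
      · simp
      · simp [mul_add]
        omega
    · rw [Set.disjoint_left]
      rintro _ ⟨a, _, rfl⟩ ⟨x, _, hx⟩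
      simp at hx
  · rw [← Set.ncard_image_of_injective {a | deg a = n} hinj, add_zero]
    congr 1
    ext ⟨a, _ | t⟩
    · simp
    · simp [mul_add]
      omega

theorem countingSeries_prod_nat_mul (R : Type*) [Ring R] {deg : α → ℕ}
    (hfin : ∀ n, {a | deg a = n}.Finite) {k : ℕ} (hk : 0 < k) :
    countingSeries R (fun x : α × ℕ => deg x.1 + k * x.2) * (1 - (X : PowerSeries R) ^ k) =
      countingSeries R deg := by
  ext n
  rw [mul_sub, mul_one, map_sub, coeff_mul_X_pow']
  simp only [countingSeries, coeff_mk]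
  rw [ncard_fiber_prod_nat hfin hk n]
  split_ifs <;> simp

end CountingSeries

section Quartic

open MvPolynomial

/-- The torus weight of the variable `x_i` of the binary quartic, normalised so that
`D1 4` raises it by one. -/
def quarticWeight (i : Fin 5) : ℤ := 2 - i

/-- The raising derivation `x_i ↦ (4 - i) x_{i+1}`, which together with `D1 4` generates an action
of `sl₂`. -/
def quarticRaise : Derivation ℂ (MvPolynomial (Fin 5) ℂ) (MvPolynomial (Fin 5) ℂ) :=
  MvPolynomial.mkDerivation ℂ fun i => (4 - (i.val : ℂ)) • X (i + 1)

/-- The space of forms of degree `n` and torus weight `m`. -/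
def quarticWeightSpace (n : ℕ) (m : ℤ) : Submodule ℂ (MvPolynomial (Fin 5) ℂ) :=
  homogeneousSubmodule (Fin 5) ℂ n ⊓ weightedHomogeneousSubmodule ℂ quarticWeight m

theorem D1_four_isWeightedHomogeneous (i : Fin 5) :
    IsWeightedHomogeneous quarticWeight ((i.val : ℂ) • (X (i - 1) : MvPolynomial (Fin 5) ℂ))
      (quarticWeight i + 1) := by
  rw [smul_eq_C_mul]
  fin_cases i
  · simpa using isWeightedHomogeneous_zero ℂ quarticWeight _
  all_goals exact (isWeightedHomogeneous_X ℂ quarticWeight _).C_mul _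

theorem quarticRaise_isWeightedHomogeneous (i : Fin 5) :
    IsWeightedHomogeneous quarticWeight ((4 - (i.val : ℂ)) • (X (i + 1) : MvPolynomial (Fin 5) ℂ))
      (quarticWeight i + -1) := by
  rw [smul_eq_C_mul]
  fin_cases i
  all_goals
    first
    | exact (isWeightedHomogeneous_X ℂ quarticWeight _).C_mul _
    | simpa using isWeightedHomogeneous_zero ℂ quarticWeight _

theorem mkDerivation_smul_X_isHomogeneous (c : Fin 5 → ℂ) (g : Fin 5 → Fin 5) {n : ℕ}
    {p : MvPolynomial (Fin 5) ℂ} (hp : p.IsHomogeneous n) :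
    (mkDerivation ℂ (fun i => c i • (X (g i) : MvPolynomial (Fin 5) ℂ)) p).IsHomogeneous n := by
  refine IsWeightedHomogeneous.mkDerivation (t := 0) (fun i => ?_) hp
  rw [smul_eq_C_mul]
  exact (isWeightedHomogeneous_X ℂ 1 (g i)).C_mul _

theorem D1_mem_quarticWeightSpace {n : ℕ} {m : ℤ} {p : MvPolynomial (Fin 5) ℂ}
    (hp : p ∈ quarticWeightSpace n m) : D1 4 p ∈ quarticWeightSpace n (m + 1) :=
  ⟨mkDerivation_smul_X_isHomogeneous _ _ hp.1, hp.2.mkDerivation D1_four_isWeightedHomogeneous⟩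

theorem quarticRaise_mem_quarticWeightSpace {n : ℕ} {m : ℤ} {p : MvPolynomial (Fin 5) ℂ}
    (hp : p ∈ quarticWeightSpace n m) : quarticRaise p ∈ quarticWeightSpace n (m - 1) :=
  ⟨mkDerivation_smul_X_isHomogeneous _ _ hp.1,
    hp.2.mkDerivation quarticRaise_isWeightedHomogeneous⟩

theorem weight_quarticWeight (s : Fin 5 →₀ ℕ) :
    Finsupp.weight quarticWeight s = 2 * s 0 + s 1 - s 3 - 2 * s 4 := by
  rw [Finsupp.weight_eq_sum, Fin.sum_univ_five]
  simp [quarticWeight]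
  ring

theorem degree_fin_five (s : Fin 5 →₀ ℕ) : s.degree = s 0 + s 1 + s 2 + s 3 + s 4 := by
  rw [Finsupp.degree_eq_sum, Fin.sum_univ_five]

theorem monomial_mem_quarticWeightSpace (s : Fin 5 →₀ ℕ) (a : ℂ) :
    monomial s a ∈ quarticWeightSpace s.degree (Finsupp.weight quarticWeight s) :=
  ⟨isHomogeneous_monomial a rfl, isWeightedHomogeneous_monomial _ _ _ rfl⟩

theorem degree_eq_and_weight_eq_of_mem_support {n : ℕ} {m : ℤ} {p : MvPolynomial (Fin 5) ℂ}
    (hp : p ∈ quarticWeightSpace n m) {s : Fin 5 →₀ ℕ} (hs : s ∈ p.support) :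
    s.degree = n ∧ Finsupp.weight quarticWeight s = m := by
  rw [mem_support_iff] at hs
  refine ⟨?_, hp.2 hs⟩
  rw [Finsupp.degree_eq_weight_one]
  exact hp.1 hs

theorem eq_zero_of_mem_quarticWeightSpace {n : ℕ} {m : ℤ} (hm : 2 * (n : ℤ) < |m|)
    {p : MvPolynomial (Fin 5) ℂ} (hp : p ∈ quarticWeightSpace n m) : p = 0 := by
  rw [← support_eq_empty, Finset.eq_empty_iff_forall_notMem]
  intro s hs
  obtain ⟨h, h'⟩ := degree_eq_and_weight_eq_of_mem_support hp hs
  rw [degree_fin_five] at h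
  rw [weight_quarticWeight] at h'
  rcases abs_cases m with h'' | h'' <;> omega

theorem D1_lie_quarticRaise :
    ⁅D1 4, quarticRaise⁆ = mkDerivation ℂ fun i => (2 * quarticWeight i : ℂ) • X i := by
  refine derivation_ext fun i => ?_
  rw [Derivation.commutator_apply, mkDerivation_X]
  fin_cases i <;> simp [D1, quarticRaise, mkDerivation_X, quarticWeight]
  all_goals first | module | norm_num

theorem mkDerivation_smul_X_monomial {σ R : Type*} [CommSemiring R] [Fintype σ] (c : σ → R)
    (s : σ →₀ ℕ) (a : R) :
    mkDerivation R (fun i => c i • (X i : MvPolynomial σ R)) (monomial s a) =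
      (∑ i, s i * c i) • monomial s a := by
  rw [mkDerivation_monomial, Finsupp.sum_fintype _ _ (by simp), Finset.sum_smul, Finset.smul_sum]
  refine Finset.sum_congr rfl fun i _ => ?_
  by_cases hi : s i = 0
  · simp [hi]
  · rw [smul_eq_mul, mul_smul_comm, X, monomial_mul, Finsupp.sub_add_single_one_cancel hi,
      smul_monomial, smul_monomial, smul_monomial]
    congr 1
    simp only [smul_eq_mul]
    ring

theorem D1_quarticRaise_apply {n : ℕ} {m : ℤ} {p : MvPolynomial (Fin 5) ℂ}
    (hp : p ∈ quarticWeightSpace n m) :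
    D1 4 (quarticRaise p) = quarticRaise (D1 4 p) + (2 * m : ℂ) • p := by
  rw [← sub_eq_iff_eq_add', ← Derivation.commutator_apply, D1_lie_quarticRaise]
  conv_lhs => rw [p.as_sum]
  conv_rhs => rw [p.as_sum]
  rw [map_sum, Finset.smul_sum]
  refine Finset.sum_congr rfl fun s hs => ?_
  rw [mkDerivation_smul_X_monomial, ← (degree_eq_and_weight_eq_of_mem_support hp hs).2,
    Finsupp.weight_eq_sum]
  congr 1
  push_cast
  rw [Finset.mul_sum]
  refine Finset.sum_congr rfl fun i _ => ?_
  simp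
  ring

theorem iterate_D1_mem_quarticWeightSpace {n : ℕ} {m : ℤ} {p : MvPolynomial (Fin 5) ℂ}
    (hp : p ∈ quarticWeightSpace n m) (k : ℕ) :
    (D1 4)^[k] p ∈ quarticWeightSpace n (m + k) := by
  induction k with
  | zero => simpa using hp
  | succ k ih =>
    rw [Function.iterate_succ_apply']
    convert D1_mem_quarticWeightSpace ih using 2
    push_cast
    ring

theorem iterate_quarticRaise_mem_quarticWeightSpace {n : ℕ} {m : ℤ}
    {p : MvPolynomial (Fin 5) ℂ} (hp : p ∈ quarticWeightSpace n m) (k : ℕ) :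
    quarticRaise^[k] p ∈ quarticWeightSpace n (m - k) := by
  induction k with
  | zero => simpa using hp
  | succ k ih =>
    rw [Function.iterate_succ_apply']
    convert quarticRaise_mem_quarticWeightSpace ih using 2
    push_cast
    ring

theorem iterate_D1_quarticRaise {n : ℕ} {m : ℤ} {p : MvPolynomial (Fin 5) ℂ}
    (hp : p ∈ quarticWeightSpace n m) (k : ℕ) :
    (D1 4)^[k + 1] (quarticRaise p) =
      quarticRaise ((D1 4)^[k + 1] p) + ((k + 1) * (2 * m + k) : ℂ) • (D1 4)^[k] p := by
  induction k with
  | zero => simpa using D1_quarticRaise_apply hp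
  | succ k ih =>
    rw [Function.iterate_succ_apply', ih, map_add, Derivation.map_smul,
      D1_quarticRaise_apply (iterate_D1_mem_quarticWeightSpace hp (k + 1)),
      ← Function.iterate_succ_apply' (D1 4) k, ← Function.iterate_succ_apply' (D1 4) (k + 1),
      add_assoc, ← add_smul]
    congr 2
    push_cast
    ring

theorem D1_iterate_quarticRaise {n : ℕ} {m : ℤ} {p : MvPolynomial (Fin 5) ℂ}
    (hp : p ∈ quarticWeightSpace n m) (hD : D1 4 p = 0) (k : ℕ) :
    D1 4 (quarticRaise^[k + 1] p) = ((k + 1) * (2 * m - k) : ℂ) • quarticRaise^[k] p := by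
  induction k with
  | zero => simpa [hD] using D1_quarticRaise_apply hp
  | succ k ih =>
    rw [Function.iterate_succ_apply',
      D1_quarticRaise_apply (iterate_quarticRaise_mem_quarticWeightSpace hp (k + 1)), ih,
      Derivation.map_smul, ← Function.iterate_succ_apply' quarticRaise k, ← add_smul]
    congr 1
    push_cast
    ring

theorem eq_zero_of_D1_eq_zero {n : ℕ} {m : ℤ} (hm : m < 0) {p : MvPolynomial (Fin 5) ℂ}
    (hp : p ∈ quarticWeightSpace n m) (hD : D1 4 p = 0) : p = 0 := by
  have key (k : ℕ) : quarticRaise^[k] p = 0 → p = 0 := by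
    induction k with
    | zero => exact id
    | succ k ih =>
      intro h
      have h' := D1_iterate_quarticRaise hp hD k
      rw [h, map_zero, eq_comm, smul_eq_zero] at h'
      refine ih (h'.resolve_left ?_)
      have h1 : ((k : ℤ) + 1) * (2 * m - k) ≠ 0 := mul_ne_zero (by omega) (by omega)
      exact_mod_cast h1
  refine key (2 * n + 1) (eq_zero_of_mem_quarticWeightSpace ?_
    (iterate_quarticRaise_mem_quarticWeightSpace hp _))
  rw [abs_of_neg] <;> push_cast <;> omega

theorem exists_D1_eq {n : ℕ} {m : ℤ} (hm : 0 < m) {p : MvPolynomial (Fin 5) ℂ}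
    (hp : p ∈ quarticWeightSpace n m) : ∃ q ∈ quarticWeightSpace n (m - 1), D1 4 q = p := by
  have key (k : ℕ) : ∀ p ∈ quarticWeightSpace n m, (D1 4)^[k] p = 0 →
      ∃ q ∈ quarticWeightSpace n (m - 1), D1 4 q = p := by
    induction k with
    | zero =>
      rintro p - rfl
      exact ⟨0, zero_mem _, map_zero _⟩
    | succ k ih =>
      intro p hp h
      have hc : ((k + 1) * (2 * m + k) : ℂ) ≠ 0 := by
        have h1 : ((k : ℤ) + 1) * (2 * m + k) ≠ 0 := mul_ne_zero (by omega) (by omega)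
        exact_mod_cast h1
      set c : ℂ := (k + 1) * (2 * m + k)
      have hE := quarticRaise_mem_quarticWeightSpace hp
      have hDE := D1_mem_quarticWeightSpace hE
      rw [sub_add_cancel] at hDE
      obtain ⟨q, hq, hqp⟩ := ih (D1 4 (quarticRaise p) - c • p)
        (sub_mem hDE (Submodule.smul_mem _ _ hp)) (by
          have h2 := iterate_D1_quarticRaise hp k
          rw [h, map_zero, zero_add, Function.iterate_succ_apply] at h2
          have h3 := ((D1 4 : Module.End ℂ (MvPolynomial (Fin 5) ℂ)) ^ k).map_sub
            (D1 4 (quarticRaise p)) (c • p)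
          simp only [map_smul, Module.End.pow_apply, Derivation.coeFn_coe] at h3
          rw [h3, h2, sub_self])
      refine ⟨c⁻¹ • (quarticRaise p - q), Submodule.smul_mem _ _ (sub_mem hE hq), ?_⟩
      rw [Derivation.map_smul, map_sub, hqp, sub_sub_cancel, inv_smul_smul₀ hc]
  refine key (2 * n + 1) p hp (eq_zero_of_mem_quarticWeightSpace ?_
    (iterate_D1_mem_quarticWeightSpace hp _))
  rw [abs_of_pos] <;> push_cast <;> omega

/-- The exponents of degree `n` whose torus weight is at least `m`. -/
def quarticExponents (n : ℕ) (m : ℤ) : Set (Fin 5 →₀ ℕ) :=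
  {s | s.degree = n ∧ m ≤ Finsupp.weight quarticWeight s}

theorem finite_quarticExponents (n : ℕ) (m : ℤ) : (quarticExponents n m).Finite :=
  (Finsupp.finite_of_degree_eq n).subset fun _ h => h.1

theorem quarticWeightSpace_le_restrictSupport {n : ℕ} {m k : ℤ} (h : k ≤ m) :
    quarticWeightSpace n m ≤ restrictSupport ℂ (quarticExponents n k) := by
  intro p hp s hs
  obtain ⟨h1, h2⟩ := degree_eq_and_weight_eq_of_mem_support hp hs
  exact ⟨h1, h2 ▸ h⟩

theorem map_D1_restrictSupport (n : ℕ) :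
    (restrictSupport ℂ (quarticExponents n 0)).map (D1 4).toLinearMap =
      restrictSupport ℂ (quarticExponents n 1) := by
  apply le_antisymm
  · rw [restrictSupport_eq_span, Submodule.map_span_le]
    rintro _ ⟨s, ⟨rfl, hs⟩, rfl⟩
    exact quarticWeightSpace_le_restrictSupport (by omega)
      (D1_mem_quarticWeightSpace (monomial_mem_quarticWeightSpace s 1))
  · rw [restrictSupport_eq_span, Submodule.span_le]
    rintro _ ⟨s, ⟨rfl, hs⟩, rfl⟩
    obtain ⟨q, hq, hqs⟩ := exists_D1_eq (by omega) (monomial_mem_quarticWeightSpace s 1)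
    exact ⟨q, quarticWeightSpace_le_restrictSupport (by omega) hq, hqs⟩

theorem restrictSupport_inf_ker_D1 (n : ℕ) :
    restrictSupport ℂ (quarticExponents n 0) ⊓ LinearMap.ker (D1 4).toLinearMap = Sn 4 n := by
  classical
  ext p
  refine and_congr_left fun hD => ⟨fun hp s hs => ?_, fun hp s hs => ⟨?_, ?_⟩⟩
  · have := (hp (mem_support_iff.2 hs)).1
    rwa [Finsupp.degree_eq_weight_one] at this
  · rw [Finsupp.degree_eq_weight_one]
    exact hp (mem_support_iff.1 hs)
  · by_contra! hneg
    set m := Finsupp.weight quarticWeight s with hm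
    have hmem : weightedHomogeneousComponent quarticWeight m p ∈ quarticWeightSpace n m := by
      refine ⟨fun d hd => ?_, weightedHomogeneousComponent_isWeightedHomogeneous _ _⟩
      rw [coeff_weightedHomogeneousComponent] at hd
      exact hp (ite_ne_right_iff.1 hd).2
    have hker : D1 4 (weightedHomogeneousComponent quarticWeight m p) = 0 := by
      have h : D1 4 p = 0 := hD
      have h' := mkDerivation_weightedHomogeneousComponent D1_four_isWeightedHomogeneous m p
      change D1 4 _ = weightedHomogeneousComponent _ _ (D1 4 p) at h'
      rw [h', h, map_zero]
    have h0 := congrArg (coeff s) (eq_zero_of_D1_eq_zero hneg hmem hker)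
    rw [coeff_weightedHomogeneousComponent, if_pos hm.symm, coeff_zero] at h0
    exact mem_support_iff.1 hs h0

theorem finrank_restrictSupport {σ K : Type*} [Field K] (s : Set (σ →₀ ℕ)) :
    Module.finrank K (restrictSupport K s) = s.ncard := by
  rw [Module.finrank_eq_nat_card_basis (basisRestrictSupport K s), Nat.card_coe_set_eq]

/-- The number of seminvariants of degree `n` is the number of monomials of torus weight zero. -/
theorem finrank_Sn_four (n : ℕ) :
    Module.finrank ℂ (Sn 4 n) =
      {s : Fin 5 →₀ ℕ | s.degree = n ∧ Finsupp.weight quarticWeight s = 0}.ncard := by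
  set A := restrictSupport ℂ (quarticExponents n 0)
  have : Finite (quarticExponents n 0) := finite_quarticExponents n 0
  have : Module.Finite ℂ A := Module.Finite.of_basis (basisRestrictSupport ℂ _)
  have h := ((D1 4).toLinearMap.domRestrict A).finrank_range_add_finrank_ker
  rw [LinearMap.range_domRestrict, map_D1_restrictSupport, LinearMap.ker_domRestrict,
    ← Submodule.finrank_map_subtype_eq, Submodule.map_comap_subtype, restrictSupport_inf_ker_D1,
    finrank_restrictSupport, finrank_restrictSupport] at h
  have h' : quarticExponents n 0 = quarticExponents n 1 ∪
      {s : Fin 5 →₀ ℕ | s.degree = n ∧ Finsupp.weight quarticWeight s = 0} := by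
    ext s
    simp only [quarticExponents, Set.mem_union, Set.mem_ofPred_eq]
    omega
  have hdisj : Disjoint (quarticExponents n 1)
      {s : Fin 5 →₀ ℕ | s.degree = n ∧ Finsupp.weight quarticWeight s = 0} := by
    rw [Set.disjoint_left]
    rintro s ⟨_, h1⟩ ⟨_, h2⟩
    omega
  rw [h', Set.ncard_union_eq hdisj (finite_quarticExponents n 1)
    ((Finsupp.finite_of_degree_eq n).subset fun _ h => h.1)] at h
  omega

/-- The monomials of torus weight zero, written as products of `x₂`, `x₁x₃`, `x₀x₄` and a power
of either `x₁²x₄` or `x₀x₃²`. -/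
def zeroWeightExponent (x : (((Bool × ℕ) × ℕ) × ℕ) × ℕ) : Fin 5 →₀ ℕ :=
  Finsupp.equivFunOnFinite.symm <|
    match x with
    | ((((false, t), p), q), e) => ![p, q + 2 * t, e, q, p + t]
    | ((((true, t), p), q), e) => ![p + t + 1, q, e, q + 2 * (t + 1), p]

theorem zeroWeightExponent_injective : Function.Injective zeroWeightExponent := by
  rintro ⟨⟨⟨⟨_ | _, t⟩, p⟩, q⟩, e⟩ ⟨⟨⟨⟨_ | _, t'⟩, p'⟩, q'⟩, e'⟩ h
  all_goals
    simp [zeroWeightExponent] at h ⊢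
    omega

/-- The degree of `zeroWeightExponent x`. -/
def zeroWeightDegree (x : (((Bool × ℕ) × ℕ) × ℕ) × ℕ) : ℕ :=
  (bif x.1.1.1.1 then 3 else 0) + 3 * x.1.1.1.2 + 2 * x.1.1.2 + 2 * x.1.2 + 1 * x.2

theorem image_zeroWeightExponent (n : ℕ) :
    zeroWeightExponent '' {x | zeroWeightDegree x = n} =
      {s : Fin 5 →₀ ℕ | s.degree = n ∧ Finsupp.weight quarticWeight s = 0} := by
  ext s
  simp only [Set.mem_image, Set.mem_ofPred_eq, degree_fin_five, weight_quarticWeight]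
  constructor
  · rintro ⟨⟨⟨⟨⟨_ | _, t⟩, p⟩, q⟩, e⟩, rfl, rfl⟩
    all_goals
      simp [zeroWeightExponent, zeroWeightDegree]
      omega
  · rintro ⟨h1, h2⟩
    rcases le_or_gt (s 0) (s 4) with h | h
    · refine ⟨((((false, s 4 - s 0), s 0), s 3), s 2), ?_, ?_⟩
      · simp [zeroWeightDegree]
        omega
      · ext i
        fin_cases i <;> simp [zeroWeightExponent] <;> omega
    · refine ⟨((((true, s 0 - s 4 - 1), s 4), s 1), s 2), ?_, ?_⟩
      · simp [zeroWeightDegree]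
        omega
      · ext i
        fin_cases i <;> simp [zeroWeightExponent] <;> omega

theorem PSeries_four_eq_countingSeries : PSeries 4 = countingSeries ℂ zeroWeightDegree := by
  ext n
  rw [PSeries, countingSeries, PowerSeries.coeff_mk, PowerSeries.coeff_mk, finrank_Sn_four,
    ← image_zeroWeightExponent, Set.ncard_image_of_injective _ zeroWeightExponent_injective]

theorem countingSeries_bool :
    countingSeries ℂ (fun b : Bool => bif b then 3 else 0) = 1 + PowerSeries.X ^ 3 := by
  ext n
  rw [countingSeries, PowerSeries.coeff_mk, map_add, PowerSeries.coeff_one,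
    PowerSeries.coeff_X_pow]
  rcases eq_or_ne n 0 with rfl | h0
  · have h : {b : Bool | (bif b then 3 else 0) = 0} = {false} := by ext b; cases b <;> simp
    simp [h]
  rcases eq_or_ne n 3 with rfl | h3
  · have h : {b : Bool | (bif b then 3 else 0) = 3} = {true} := by ext b; cases b <;> simp
    simp [h]
  · have h : {b : Bool | (bif b then 3 else 0) = n} = ∅ := by
      ext b
      cases b <;> simp [h0.symm, h3.symm]
    simp [h, h0, h3]

end Quartic

/-- The Poincaré series of the algebra of covariants of the binary 4-form. -/
theorem poincare_series_d4 :
    PSeries 4 = (1 + (PowerSeries.X : PowerSeries ℂ) ^ 3) * ((1 - (PowerSeries.X : PowerSeries ℂ)) * (1 - (PowerSeries.X : PowerSeries ℂ) ^ 2) ^ 2 * (1 - (PowerSeries.X : PowerSeries ℂ) ^ 3))⁻¹ := by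
  have h0 (n : ℕ) : {b : Bool | (bif b then 3 else 0) = n}.Finite := Set.toFinite _
  have h1 := finite_fiber_prod_nat h0 (k := 3) (by norm_num)
  have h2 := finite_fiber_prod_nat h1 (k := 2) (by norm_num)
  have h3 := finite_fiber_prod_nat h2 (k := 2) (by norm_num)
  rw [PowerSeries.eq_mul_inv_iff_mul_eq (by simp), PSeries_four_eq_countingSeries,
    ← countingSeries_bool, ← countingSeries_prod_nat_mul ℂ h0 (k := 3) (by norm_num),
    ← countingSeries_prod_nat_mul ℂ h1 (k := 2) (by norm_num),
    ← countingSeries_prod_nat_mul ℂ h2 (k := 2) (by norm_num),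
    ← countingSeries_prod_nat_mul ℂ h3 (k := 1) (by norm_num)]
  change countingSeries ℂ zeroWeightDegree * _ =
    countingSeries ℂ zeroWeightDegree * _ * _ * _ * _
  ring

end
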